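/- arXiv:1603.05711 — 2 statements merged into one kernel-verified Lean document; each statement's English description precedes it below -/
import Mathlib

section
/- Let R = S ×_k T be a non-trivial fiber product. Let M_1, N_1 be first syzygies over S of finitely generated S-modules, and let M_2, N_2 be first syzygies over T of finitely generated T-modules, all regarded as R-modules. Set M := M_1 ⊕ M_2 and N := N_1 ⊕ N_2. If Tor_1^R(M, N) = 0 = Tor_2^R(M, N), then M = 0 or N = 0. -/
open CategoryTheory Opposite IsLocalRing

noncomputable section

/-- Vanishing of `Tor_i^A(M, N)`. -/
abbrev TorZero (A : Type) [CommRing A] (M N : Type) [AddCommGroup M] [Module A M]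
    [AddCommGroup N] [Module A N] (i : ℕ) : Prop :=
  Subsingleton (((Tor (ModuleCat A) i).obj (ModuleCat.of A M)).obj (ModuleCat.of A N))

/-- Vanishing of `Ext^i_A(M, N)`. -/
abbrev ExtZero (A : Type) [CommRing A] (M N : Type) [AddCommGroup M] [Module A M]
    [AddCommGroup N] [Module A N] (i : ℕ) : Prop :=
  Subsingleton (((Ext A (ModuleCat A) i).obj (op (ModuleCat.of A M))).obj (ModuleCat.of A N))

/-- `M` has projective dimension at most `n` over `A`:
`Ext^i_A(M, -) = 0` for all `i > n`. -/
def PdLE (A : Type) [CommRing A] (M : Type) [AddCommGroup M] [Module A M] (n : ℕ) : Prop :=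
  ∀ (N : ModuleCat A) (i : ℕ), n < i →
    Subsingleton (((Ext A (ModuleCat A) i).obj (op (ModuleCat.of A M))).obj N)

/-- `N` has injective dimension at most `n` over `A`:
`Ext^i_A(-, N) = 0` for all `i > n`. -/
def IdLE (A : Type) [CommRing A] (N : Type) [AddCommGroup N] [Module A N] (n : ℕ) : Prop :=
  ∀ (X : ModuleCat A) (i : ℕ), n < i →
    Subsingleton (((Ext A (ModuleCat A) i).obj (op X)).obj (ModuleCat.of A N))

/-- The depth of a module over a noetherian local ring, as an extended natural number:
`inf { i | Ext^i_A(k, M) ≠ 0 }`. -/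
def depthM (A : Type) [CommRing A] [IsLocalRing A] (M : Type) [AddCommGroup M]
    [Module A M] : ℕ∞ :=
  sInf {n : ℕ∞ | ∃ i : ℕ, n = i ∧
    ¬ Subsingleton (((Ext A (ModuleCat A) i).obj
        (op (ModuleCat.of A (A ⧸ maximalIdeal A)))).obj (ModuleCat.of A M))}

/-- The fiber product `S ×ₖ T` as a subring of `S × T`. -/
def fiberProd {S T k : Type} [CommRing S] [CommRing T] [CommRing k]
    (πS : S →+* k) (πT : T →+* k) : Subring (S × T) :=
  RingHom.eqLocus (πS.comp (RingHom.fst S T)) (πT.comp (RingHom.snd S T))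

/-- The projection from the fiber product to `S`. -/
def ρS {S T k : Type} [CommRing S] [CommRing T] [CommRing k]
    (πS : S →+* k) (πT : T →+* k) : ↥(fiberProd πS πT) →+* S :=
  (RingHom.fst S T).comp (fiberProd πS πT).subtype

/-- The projection from the fiber product to `T`. -/
def ρT {S T k : Type} [CommRing S] [CommRing T] [CommRing k]
    (πS : S →+* k) (πT : T →+* k) : ↥(fiberProd πS πT) →+* T :=
  (RingHom.snd S T).comp (fiberProd πS πT).subtype

/-- The `i`-th Betti number of a module `M` over a noetherian local ring `A`:
the `k`-dimension of `Tor_i^A(M, k) ⊗_A k`; since `Tor_i^A(M, k)` is annihilated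
by the maximal ideal, this is `dim_k Tor_i^A(M, k)`. -/
noncomputable def betti (A : Type) [CommRing A] [IsLocalRing A] (M : Type) [AddCommGroup M]
    [Module A M] (i : ℕ) : ℕ :=
  let X : ModuleCat A :=
    ((Tor (ModuleCat A) i).obj (ModuleCat.of A M)).obj (ModuleCat.of A (A ⧸ maximalIdeal A))
  Module.finrank (A ⧸ maximalIdeal A) (X ⧸ (maximalIdeal A • (⊤ : Submodule A X)))

/-- `M` is a first syzygy over `A` of a finitely generated `A`-module, i.e. `M` embeds
into a finite free `A`-module (as the kernel of `F ↠ L` for the quotient `L`). -/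
def IsFirstSyzygy (A : Type) [CommRing A] (M : Type) [AddCommGroup M] [Module A M] : Prop :=
  ∃ (n : ℕ) (f : M →ₗ[A] (Fin n → A)), Function.Injective f

section Exactness

variable {R : Type} [CommRing R]

/-- A map out of a projective module into the kernel of `p` factors through `f`, if
`(f, p)` is exact. -/
lemma exists_comp_eq_of_projective {P A B C : Type} [AddCommGroup P] [Module R P]
    [AddCommGroup A] [Module R A] [AddCommGroup B] [Module R B] [AddCommGroup C] [Module R C]
    [Module.Projective R P] (f : A →ₗ[R] B) (p : B →ₗ[R] C) (hfp : Function.Exact f p)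
    (ψ : P →ₗ[R] B) (hψ : ∀ x, p (ψ x) = 0) :
    ∃ α : P →ₗ[R] A, ∀ x, f (α x) = ψ x := by
  obtain ⟨α, hα⟩ := Module.projective_lifting_property f.rangeRestrict
    (ψ.codRestrict (LinearMap.range f) fun x => (hfp _).1 (hψ x)) f.surjective_rangeRestrict
  exact ⟨α, fun x => congrArg Subtype.val (LinearMap.congr_fun hα x)⟩

variable (X : Type) [AddCommGroup X] [Module R X]
  {P0 P1 P2 P3 Y : Type} [AddCommGroup P0] [Module R P0] [AddCommGroup P1] [Module R P1]
  [AddCommGroup P2] [Module R P2] [AddCommGroup P3] [Module R P3] [AddCommGroup Y] [Module R Y]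
  {A B : Type} [AddCommGroup A] [Module R A] [AddCommGroup B] [Module R B]

/-- If `X ⊗ -` preserves exactness of a projective resolution of `Y` in degree one, then it
preserves injectivity of the kernel of any surjection onto `Y`. -/
lemma lTensor_injective_of_exact_one [Module.Projective R P0] [Module.Projective R P1]
    (d2 : P2 →ₗ[R] P1) (d1 : P1 →ₗ[R] P0) (d0 : P0 →ₗ[R] Y)
    (h21 : Function.Exact d2 d1) (h10 : Function.Exact d1 d0) (h0 : Function.Surjective d0)
    (hX : Function.Exact (d2.lTensor X) (d1.lTensor X))
    (f : A →ₗ[R] B) (p : B →ₗ[R] Y) (hf : Function.Injective f)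
    (hfp : Function.Exact f p) (hp : Function.Surjective p) :
    Function.Injective (f.lTensor X) := by
  obtain ⟨φ, hφ⟩ := Module.projective_lifting_property p d0 hp
  replace hφ : ∀ x, p (φ x) = d0 x := LinearMap.congr_fun hφ
  obtain ⟨α, hα⟩ := exists_comp_eq_of_projective f p hfp (-(φ ∘ₗ d1))
    (fun x => by simp [hφ, h10.apply_apply_eq_zero])
  simp only [LinearMap.neg_apply, LinearMap.comp_apply] at hα
  have hex : Function.Exact (d1.prod α) (φ.coprod f) := by
    rintro ⟨x, a⟩
    simp only [LinearMap.coprod_apply, Set.mem_range, LinearMap.prod_apply, Function.prod_apply,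
      Prod.mk.injEq]
    constructor
    · intro h
      obtain ⟨y, rfl⟩ := (h10 x).1 (by
        have := congrArg p h
        simpa [hφ, hfp.apply_apply_eq_zero] using this)
      exact ⟨y, rfl, hf (by rw [hα]; exact (eq_neg_of_add_eq_zero_right h).symm)⟩
    · rintro ⟨y, rfl, rfl⟩
      simp [hα]
  have hsurj : Function.Surjective (φ.coprod f) := by
    intro b
    obtain ⟨x, hx⟩ := h0 (p b)
    obtain ⟨a, ha⟩ := (hfp (b - φ x)).1 (by simp [hφ, hx])
    exact ⟨(x, a), by simp [ha]⟩
  have hex' := lTensor_exact X hex hsurj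
  rw [injective_iff_map_eq_zero]
  intro z hz
  obtain ⟨w, hw⟩ := (hex' ((LinearMap.inr R P0 A).lTensor X z)).1 (by
    rw [← LinearMap.lTensor_comp_apply, LinearMap.coprod_inr, hz])
  have h1 := congrArg ((LinearMap.fst R P0 A).lTensor X) hw
  have h2 := congrArg ((LinearMap.snd R P0 A).lTensor X) hw
  rw [← LinearMap.lTensor_comp_apply, ← LinearMap.lTensor_comp_apply, LinearMap.fst_prod,
    LinearMap.fst_comp_inr, LinearMap.lTensor_zero, LinearMap.zero_apply] at h1
  rw [← LinearMap.lTensor_comp_apply, ← LinearMap.lTensor_comp_apply, LinearMap.snd_prod,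
    LinearMap.snd_comp_inr, LinearMap.lTensor_id, LinearMap.id_apply] at h2
  obtain ⟨v, rfl⟩ := (hX w).1 h1
  have hz0 : α ∘ₗ d2 = 0 := LinearMap.ext fun x => hf (by
    simp [hα, h21.apply_apply_eq_zero])
  rw [← h2, ← LinearMap.lTensor_comp_apply, hz0, LinearMap.lTensor_zero, LinearMap.zero_apply]

/-- If `X ⊗ -` preserves exactness of a projective resolution of `Y` in degree two, then it
preserves injectivity of the kernel of any surjection onto a first syzygy of `Y`. -/
lemma lTensor_injective_of_exact_two [Module.Projective R P0] [Module.Projective R P1]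
    [Module.Projective R P2]
    (d3 : P3 →ₗ[R] P2) (d2 : P2 →ₗ[R] P1) (d1 : P1 →ₗ[R] P0) (d0 : P0 →ₗ[R] Y)
    (h32 : Function.Exact d3 d2)
    (h21 : Function.Exact d2 d1) (h10 : Function.Exact d1 d0) (h0 : Function.Surjective d0)
    (hX : Function.Exact (d3.lTensor X) (d2.lTensor X)) [Module.Projective R B]
    (f : A →ₗ[R] B) (p : B →ₗ[R] Y) (hf : Function.Injective f)
    (hfp : Function.Exact f p) (hp : Function.Surjective p)
    {A' B' : Type} [AddCommGroup A'] [Module R A'] [AddCommGroup B'] [Module R B']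
    (i : A' →ₗ[R] B') (q : B' →ₗ[R] A) (hi : Function.Injective i)
    (hiq : Function.Exact i q) (hq : Function.Surjective q) :
    Function.Injective (i.lTensor X) := by
  obtain ⟨φ, hφ⟩ := Module.projective_lifting_property p d0 hp
  replace hφ : ∀ x, p (φ x) = d0 x := LinearMap.congr_fun hφ
  obtain ⟨α, hα⟩ := exists_comp_eq_of_projective f p hfp (-(φ ∘ₗ d1))
    (fun x => by simp [hφ, h10.apply_apply_eq_zero])
  simp only [LinearMap.neg_apply, LinearMap.comp_apply] at hα
  obtain ⟨φ', hφ'⟩ := Module.projective_lifting_property q α hq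
  replace hφ' : ∀ x, q (φ' x) = α x := LinearMap.congr_fun hφ'
  obtain ⟨β, hβ⟩ := exists_comp_eq_of_projective i q hiq (-(φ' ∘ₗ d2)) (fun x => by
    have : α (d2 x) = 0 := hf (by simp [hα, h21.apply_apply_eq_zero])
    simp [hφ', this])
  simp only [LinearMap.neg_apply, LinearMap.comp_apply] at hβ
  have hsurj : Function.Surjective (φ.coprod (f ∘ₗ q)) := by
    intro b
    obtain ⟨x, hx⟩ := h0 (p b)
    obtain ⟨a, ha⟩ := (hfp (b - φ x)).1 (by simp [hφ, hx])
    obtain ⟨b', rfl⟩ := hq a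
    exact ⟨(x, b'), by simp [ha]⟩
  obtain ⟨σ, hσ⟩ := Module.projective_lifting_property _ LinearMap.id hsurj
  replace hσ : ∀ b, φ (σ b).1 + f (q (σ b).2) = b := fun b => by
    simpa using LinearMap.congr_fun hσ b
  set D : (P1 × A') × B →ₗ[R] P0 × B' :=
    ((d1 ∘ₗ LinearMap.fst R P1 A').prod (φ'.coprod i)).coprod σ with hD
  have hDapp : ∀ x a b, D ((x, a), b) = (d1 x + (σ b).1, φ' x + i a + (σ b).2) :=
    fun x a b => by ext <;> simp [hD]
  have hcone : ∀ x a, φ (d1 x) + f (q (φ' x + i a)) = 0 := fun x a => by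
    simp [hφ', hα, hiq.apply_apply_eq_zero]
  have hDsurj : Function.Surjective D := by
    rintro ⟨x, b'⟩
    set b := φ x + f (q b') with hb
    have h1 : φ (x - (σ b).1) + f (q (b' - (σ b).2)) = 0 := by
      have := hσ b
      simp only [map_sub]
      rw [sub_add_sub_comm, this, hb, sub_self]
    obtain ⟨y, hy⟩ := (h10 (x - (σ b).1)).1 (by
      have := congrArg p h1
      simpa only [map_add, hφ, hfp.apply_apply_eq_zero, add_zero, map_zero] using this)
    obtain ⟨a, ha⟩ := (hiq (b' - (σ b).2 - φ' y)).1 (by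
      rw [map_sub, hφ', sub_eq_zero]
      apply hf
      rw [hα, hy]
      exact eq_neg_of_add_eq_zero_right h1)
    refine ⟨((y, a), b), ?_⟩
    rw [hDapp, hy, ha]
    ext <;> simp
  have hex : Function.Exact (LinearMap.inl R (P1 × A') B ∘ₗ d2.prod β) D := by
    rintro ⟨⟨x, a⟩, b⟩
    rw [hDapp]
    simp only [Set.mem_range, LinearMap.comp_apply, LinearMap.prod_apply, Function.prod_apply,
      LinearMap.inl_apply, Prod.mk.injEq, Prod.mk_eq_zero]
    constructor
    · rintro ⟨h1, h2⟩
      have hb : b = 0 := by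
        rw [← hσ b, eq_neg_of_add_eq_zero_right h1, eq_neg_of_add_eq_zero_right h2]
        simp only [map_neg]
        rw [← neg_add, hcone, neg_zero]
      subst hb
      simp only [map_zero, Prod.fst_zero, Prod.snd_zero, add_zero] at h1 h2
      obtain ⟨y, rfl⟩ := (h21 x).1 h1
      exact ⟨y, ⟨rfl, hi (by rw [hβ]; exact (eq_neg_of_add_eq_zero_right h2).symm)⟩, rfl⟩
    · rintro ⟨y, ⟨rfl, rfl⟩, rfl⟩
      simp [hβ, h21.apply_apply_eq_zero]
  have hex' := lTensor_exact X hex hDsurj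
  rw [injective_iff_map_eq_zero]
  intro z hz
  obtain ⟨w, hw⟩ := (hex'
    ((LinearMap.inl R (P1 × A') B ∘ₗ LinearMap.inr R P1 A').lTensor X z)).1 (by
    have : D ∘ₗ LinearMap.inl R (P1 × A') B ∘ₗ LinearMap.inr R P1 A' =
        LinearMap.inr R P0 B' ∘ₗ i := by
      ext a <;> simp [hDapp]
    rw [← LinearMap.lTensor_comp_apply, this, LinearMap.lTensor_comp_apply, hz, map_zero])
  have h1 := congrArg ((LinearMap.fst R P1 A' ∘ₗ LinearMap.fst R (P1 × A') B).lTensor X) hw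
  have h2 := congrArg ((LinearMap.snd R P1 A' ∘ₗ LinearMap.fst R (P1 × A') B).lTensor X) hw
  rw [← LinearMap.lTensor_comp_apply, ← LinearMap.lTensor_comp_apply,
    show (LinearMap.fst R P1 A' ∘ₗ LinearMap.fst R (P1 × A') B) ∘ₗ
      (LinearMap.inl R (P1 × A') B ∘ₗ d2.prod β) = d2 from rfl,
    show (LinearMap.fst R P1 A' ∘ₗ LinearMap.fst R (P1 × A') B) ∘ₗ
      (LinearMap.inl R (P1 × A') B ∘ₗ LinearMap.inr R P1 A') = 0 from rfl,
    LinearMap.lTensor_zero, LinearMap.zero_apply] at h1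
  rw [← LinearMap.lTensor_comp_apply, ← LinearMap.lTensor_comp_apply,
    show (LinearMap.snd R P1 A' ∘ₗ LinearMap.fst R (P1 × A') B) ∘ₗ
      (LinearMap.inl R (P1 × A') B ∘ₗ d2.prod β) = β from rfl,
    show (LinearMap.snd R P1 A' ∘ₗ LinearMap.fst R (P1 × A') B) ∘ₗ
      (LinearMap.inl R (P1 × A') B ∘ₗ LinearMap.inr R P1 A') = LinearMap.id from rfl,
    LinearMap.lTensor_id, LinearMap.id_apply] at h2
  obtain ⟨v, rfl⟩ := (hX w).1 h1
  have hz0 : β ∘ₗ d3 = 0 := LinearMap.ext fun x => hi (by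
    simp [hβ, h32.apply_apply_eq_zero])
  rw [← h2, ← LinearMap.lTensor_comp_apply, hz0, LinearMap.lTensor_zero, LinearMap.zero_apply]

end Exactness

section Tor

variable {R : Type} [CommRing R] {X Y : Type} [AddCommGroup X] [Module R X]
  [AddCommGroup Y] [Module R Y]

/-- `X ⊗ -` preserves exactness of a projective resolution of `Y` in positive degrees in which
`Tor(X, Y)` vanishes. -/
lemma TorZero.exact_lTensor {n : ℕ} (h : TorZero R X Y (n + 1))
    (P : ProjectiveResolution (ModuleCat.of R Y)) :
    Function.Exact ((P.complex.d (n + 2) (n + 1)).hom.lTensor X)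
      ((P.complex.d (n + 1) n).hom.lTensor X) := by
  have hz := (@ModuleCat.isZero_of_subsingleton _ _ _ h).of_iso
    (P.isoLeftDerivedObj ((MonoidalCategory.tensoringLeft _).obj (ModuleCat.of R X)) (n + 1)).symm
  have hex := (HomologicalComplex.exactAt_iff_isZero_homology _ _).2 hz
  rw [HomologicalComplex.exactAt_iff' _ (n + 2) (n + 1) n (by simp) (by simp)] at hex
  exact (ShortComplex.ShortExact.moduleCat_exact_iff_function_exact _).1 hex

variable {A B : Type} [AddCommGroup A] [Module R A] [AddCommGroup B] [Module R B]

lemma ModuleCat.exact_resolution (P : ProjectiveResolution (ModuleCat.of R Y)) (n : ℕ) :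
    Function.Exact (P.complex.d (n + 2) (n + 1)).hom (P.complex.d (n + 1) n).hom :=
  (ShortComplex.ShortExact.moduleCat_exact_iff_function_exact _).1 (P.exact_succ n)

lemma ModuleCat.exact_augmentation (P : ProjectiveResolution (ModuleCat.of R Y)) :
    Function.Exact (P.complex.d 1 0).hom
      (show P.complex.X 0 ⟶ ModuleCat.of R Y from P.π.f 0).hom :=
  (ShortComplex.ShortExact.moduleCat_exact_iff_function_exact _).1 P.exact₀

lemma ModuleCat.surjective_augmentation (P : ProjectiveResolution (ModuleCat.of R Y)) :
    Function.Surjective (show P.complex.X 0 ⟶ ModuleCat.of R Y from P.π.f 0).hom :=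
  (ModuleCat.epi_iff_surjective _).1 (inferInstanceAs (Epi (P.π.f 0)))

/-- If `Tor₁(X, Y) = 0`, then `X ⊗ -` preserves injectivity of the kernel of any surjection
onto `Y`. -/
lemma TorZero.lTensor_injective (h : TorZero R X Y 1)
    (f : A →ₗ[R] B) (p : B →ₗ[R] Y) (hf : Function.Injective f)
    (hfp : Function.Exact f p) (hp : Function.Surjective p) :
    Function.Injective (f.lTensor X) := by
  let P := projectiveResolution (ModuleCat.of R Y)
  exact lTensor_injective_of_exact_one X _ _ _ (ModuleCat.exact_resolution P 0)
    (ModuleCat.exact_augmentation P) (ModuleCat.surjective_augmentation P) (h.exact_lTensor P)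
    f p hf hfp hp

/-- If `Tor₂(X, Y) = 0`, then `X ⊗ -` preserves injectivity of the kernel of any surjection
onto a first syzygy of `Y`. -/
lemma TorZero.lTensor_injective_of_syzygy (h : TorZero R X Y 2) [Module.Projective R B]
    (f : A →ₗ[R] B) (p : B →ₗ[R] Y) (hf : Function.Injective f)
    (hfp : Function.Exact f p) (hp : Function.Surjective p)
    {A' B' : Type} [AddCommGroup A'] [Module R A'] [AddCommGroup B'] [Module R B']
    (i : A' →ₗ[R] B') (q : B' →ₗ[R] A) (hi : Function.Injective i)
    (hiq : Function.Exact i q) (hq : Function.Surjective q) :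
    Function.Injective (i.lTensor X) := by
  let P := projectiveResolution (ModuleCat.of R Y)
  exact lTensor_injective_of_exact_two X _ _ _ _ (ModuleCat.exact_resolution P 1)
    (ModuleCat.exact_resolution P 0) (ModuleCat.exact_augmentation P)
    (ModuleCat.surjective_augmentation P) (h.exact_lTensor P) f p hf hfp hp i q hi hiq hq

end Tor

section Functionals

variable {R k : Type} [CommRing R] [Field k] [Algebra R k]

/-- `j` has a nonzero image under some functional on the kernel of a functional to `k`, of the
form that arises from a nonzero functional on the maximal ideal of a quotient ring of `R`. -/
def IsDetected (k : Type) [Field k] [Algebra R k] (j : R) : Prop :=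
  ∃ (L : Type) (_ : AddCommGroup L) (_ : Module R L) (τ : L →ₗ[R] k) (e : L)
    (ψ : LinearMap.ker τ →ₗ[R] k) (h : j • e ∈ LinearMap.ker τ), τ e = 1 ∧ ψ ⟨j • e, h⟩ = 1

/-- If some detected `j` kills `x` and `y`, then a short exact sequence ending in `Y`, obtained as
a pullback, does not remain exact after tensoring with `X`. -/
lemma exists_not_injective_lTensor (hsurj : Function.Surjective (algebraMap R k))
    {X Y : Type} [AddCommGroup X] [Module R X] [AddCommGroup Y] [Module R Y]
    (φ : X →ₗ[R] k) (x : X) (hx : φ x = 1) (g : Y →ₗ[R] k) (y : Y) (hy : g y = 1)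
    (j : R) (hj : IsDetected k j) (hjx : j • x = 0) (hjy : j • y = 0) :
    ∃ (A B : Type) (_ : AddCommGroup A) (_ : AddCommGroup B) (_ : Module R A) (_ : Module R B)
      (i : A →ₗ[R] B) (q : B →ₗ[R] Y), Function.Injective i ∧ Function.Exact i q ∧
        Function.Surjective q ∧ ¬ Function.Injective (i.lTensor X) := by
  obtain ⟨L, _, _, τ, e, ψ, hk, he, hψ⟩ := hj
  let B : Submodule R (Y × L) :=
    LinearMap.eqLocus (g ∘ₗ LinearMap.fst R Y L) (τ ∘ₗ LinearMap.snd R Y L)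
  let i : LinearMap.ker τ →ₗ[R] B :=
    (LinearMap.inr R Y L ∘ₗ (LinearMap.ker τ).subtype).codRestrict B fun a => by
      simp [B, LinearMap.mem_eqLocus]
  let q : B →ₗ[R] Y := LinearMap.fst R Y L ∘ₗ B.subtype
  refine ⟨LinearMap.ker τ, B, _, _, _, _, i, q, ?_, ?_, ?_, ?_⟩
  · intro a b hab
    exact Subtype.ext (congrArg (fun z : B => z.1.2) hab)
  · rintro ⟨⟨y', l⟩, hl⟩
    constructor
    · rintro rfl
      refine ⟨⟨l, ?_⟩, rfl⟩
      have : g 0 = τ l := hl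
      rw [LinearMap.mem_ker, ← this, map_zero]
    · rintro ⟨a, ha⟩
      exact (congrArg (fun z : B => z.1.1) ha).symm
  · intro y'
    obtain ⟨r, hr⟩ := hsurj (g y')
    refine ⟨⟨(y', r • e), ?_⟩, rfl⟩
    change g y' = τ (r • e)
    rw [map_smul, he, Algebra.smul_def, mul_one, hr]
  · intro hinj
    have h0 : x ⊗ₜ[R] (⟨j • e, hk⟩ : LinearMap.ker τ) = 0 := by
      apply hinj
      have hi : i ⟨j • e, hk⟩ = j • (⟨(y, e), hy.trans he.symm⟩ : B) :=
        Subtype.ext (Prod.ext hjy.symm rfl)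
      rw [map_zero, LinearMap.lTensor_tmul, hi, TensorProduct.tmul_smul,
        TensorProduct.smul_tmul', hjx, TensorProduct.zero_tmul]
    have h1 := congrArg (LinearMap.mul' R k ∘ₗ TensorProduct.map φ ψ) h0
    simp [hx, hψ] at h1

lemma not_torZero_one (hsurj : Function.Surjective (algebraMap R k))
    {X Y : Type} [AddCommGroup X] [Module R X] [AddCommGroup Y] [Module R Y]
    (φ : X →ₗ[R] k) (x : X) (hx : φ x = 1) (g : Y →ₗ[R] k) (y : Y) (hy : g y = 1)
    (j : R) (hj : IsDetected k j) (hjx : j • x = 0) (hjy : j • y = 0) :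
    ¬ TorZero R X Y 1 := by
  obtain ⟨A, B, _, _, _, _, i, q, hi, hiq, hq, hX⟩ :=
    exists_not_injective_lTensor hsurj φ x hx g y hy j hj hjx hjy
  exact fun h => hX (h.lTensor_injective i q hi hiq hq)

lemma not_torZero_two (hsurj : Function.Surjective (algebraMap R k))
    {X Y : Type} [AddCommGroup X] [Module R X] [AddCommGroup Y] [Module R Y]
    (φ : X →ₗ[R] k) (x : X) (hx : φ x = 1) (g : Y →ₗ[R] k) (y : Y) (hy : g y = 1)
    (j j' : R) (hj : IsDetected k j) (hj' : IsDetected k j') (hjj' : j * j' = 0)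
    (hjx : j • x = 0) (hjy : j' • y = 0) :
    ¬ TorZero R X Y 2 := by
  obtain ⟨L, _, _, τ, e, ψ, hk, he, hψ⟩ := hj'
  let p : (Y →₀ R) →ₗ[R] Y := Finsupp.linearCombination R id
  let b : Y →₀ R := Finsupp.single y 1
  have hb : p b = y := by simp [p, b]
  have hp : Function.Surjective p := fun z => ⟨Finsupp.single z 1, by simp [p]⟩
  obtain ⟨H, hH⟩ := Module.projective_lifting_property (Algebra.linearMap R k) (g ∘ₗ p) hsurj
  replace hH : ∀ z, algebraMap R k (H z) = g (p z) := LinearMap.congr_fun hH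
  let γ : LinearMap.ker p →ₗ[R] LinearMap.ker τ :=
    (LinearMap.toSpanSingleton R L e ∘ₗ H ∘ₗ (LinearMap.ker p).subtype).codRestrict _
      fun a => by
        have : algebraMap R k (H a) = 0 := by rw [hH, LinearMap.mem_ker.1 a.2, map_zero]
        simp [he, Algebra.smul_def, this]
  have hbk : j' • b ∈ LinearMap.ker p := by rw [LinearMap.mem_ker, map_smul, hb, hjy]
  have hγ : (ψ ∘ₗ γ) ⟨j' • b, hbk⟩ = 1 := by
    have : γ ⟨j' • b, hbk⟩ = H b • ⟨j' • e, hk⟩ := Subtype.ext (by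
      change H (j' • b) • e = H b • j' • e
      rw [map_smul, smul_assoc, smul_comm])
    rw [LinearMap.comp_apply, this, map_smul, hψ, Algebra.smul_def, hH, hb, hy, one_mul]
  obtain ⟨A', B', _, _, _, _, i, q, hi, hiq, hq, hX⟩ :=
    exists_not_injective_lTensor hsurj φ x hx (ψ ∘ₗ γ) ⟨j' • b, hbk⟩ hγ j hj hjx
      (Subtype.ext (by
        change j • j' • b = 0
        rw [smul_smul, hjj', zero_smul]))
  exact fun h => hX (h.lTensor_injective_of_syzygy (LinearMap.ker p).subtype p
    (Submodule.subtype_injective _) (LinearMap.exact_subtype_ker_map p) hp i q hi hiq hq)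

/-- A nonzero finitely generated module over a local ring has a nonzero functional to the
residue field. -/
lemma exists_functional {A M : Type} [CommRing A] [IsLocalRing A] (π : A →+* k)
    (hk : RingHom.ker π = maximalIdeal A)
    [AddCommGroup M] [Module A M] [Module.Finite A M] [Nontrivial M] :
    ∃ (φ : M →+ k) (x : M), (∀ (a : A) m, φ (a • m) = π a * φ m) ∧ φ x = 1 := by
  obtain ⟨N, hN, -⟩ := (eq_top_or_exists_le_coatom (⊥ : Submodule A M)).resolve_left bot_ne_top
  obtain ⟨I, hI, ⟨ε⟩⟩ := isSimpleModule_iff_quot_maximal.1 (isSimpleModule_iff_isCoatom.2 hN)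
  obtain rfl := IsLocalRing.eq_maximalIdeal hI
  let θ : A ⧸ maximalIdeal A →+* k := Ideal.Quotient.lift _ π fun a ha => by
    rwa [← hk] at ha
  have hθ : ∀ (a : A) z, θ (a • z) = π a * θ z := fun a z => by
    rw [Algebra.smul_def, map_mul]
    rfl
  obtain ⟨x, hx⟩ := N.mkQ_surjective (ε.symm 1)
  refine ⟨(θ : A ⧸ maximalIdeal A →+ k).comp (ε.toLinearMap ∘ₗ N.mkQ).toAddMonoidHom, x,
    fun a m => ?_, ?_⟩
  · change θ (ε (N.mkQ (a • m))) = π a * θ (ε (N.mkQ m))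
    rw [map_smul, map_smul, hθ]
  · change θ (ε (N.mkQ x)) = 1
    rw [hx, ε.apply_symm_apply, map_one]

/-- The functional of `exists_functional`, made linear over a ring mapping to `A`. -/
lemma exists_linear_functional {A M : Type} [CommRing A] [IsLocalRing A] (π : A →+* k)
    (hk : RingHom.ker π = maximalIdeal A) (ρ : R →+* A) (hρ : ∀ r, algebraMap R k r = π (ρ r))
    [AddCommGroup M] [Module A M] [Module.Finite A M] [Module R M]
    (hM : ∀ (r : R) (m : M), r • m = ρ r • m) (hne : ¬ Subsingleton M) :
    ∃ (φ : M →ₗ[R] k) (x : M), φ x = 1 := by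
  have := not_subsingleton_iff_nontrivial.1 hne
  obtain ⟨φ, x, hφ, hx⟩ := exists_functional (M := M) π hk
  exact ⟨{ φ with
    map_smul' := fun r m => by
      change φ (r • m) = r • φ m
      rw [hM, hφ, Algebra.smul_def, hρ] }, x, hx⟩

lemma exists_isDetected {A : Type} [CommRing A] [IsLocalRing A] [IsNoetherianRing A]
    (π : A →+* k) (hk : RingHom.ker π = maximalIdeal A) (ρ : R →+* A)
    (hρ : ∀ r, algebraMap R k r = π (ρ r)) (hA : maximalIdeal A ≠ ⊥) :
    ∃ a ∈ maximalIdeal A, ∀ j, ρ j = a → IsDetected k j := by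
  have := Submodule.nontrivial_iff_ne_bot.2 hA
  obtain ⟨φ, x, hφ, hx⟩ := exists_functional (M := maximalIdeal A) π hk
  refine ⟨x, x.2, fun j hj => ?_⟩
  let _ : Module R A := Module.compHom A ρ
  let τ : A →ₗ[R] k :=
    { (π : A →+ k) with
      map_smul' := fun r a => by
        change π (ρ r * a) = r • π a
        rw [map_mul, Algebra.smul_def, hρ] }
  have hτ : ∀ a, a ∈ LinearMap.ker τ ↔ a ∈ maximalIdeal A := fun a => by rw [← hk]; rfl
  let ψ : LinearMap.ker τ →ₗ[R] k :=
    { toFun := fun a => φ ⟨a, (hτ a).1 a.2⟩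
      map_add' := fun a b => map_add φ ⟨a, (hτ a).1 a.2⟩ ⟨b, (hτ b).1 b.2⟩
      map_smul' := fun r a => by
        change φ (ρ r • ⟨a, (hτ a).1 a.2⟩) = r • φ ⟨a, (hτ a).1 a.2⟩
        rw [hφ, Algebra.smul_def, hρ] }
  have hj1 : j • (1 : A) = x := by
    change ρ j * 1 = x
    rw [mul_one, hj]
  have hmem : j • (1 : A) ∈ LinearMap.ker τ := by rw [hj1, hτ]; exact x.2
  refine ⟨A, _, _, τ, 1, ψ, hmem, map_one π, ?_⟩
  change φ ⟨j • (1 : A), _⟩ = 1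
  rw [← hx]
  exact congrArg φ (Subtype.ext hj1)

end Functionals

/-- Lemma 2.10: if `M₁, N₁` are first syzygies over `S` and `M₂, N₂` are first syzygies
over `T` (all regarded as modules over the fiber product `R = S ×ₖ T`), `M := M₁ ⊕ M₂`,
`N := N₁ ⊕ N₂`, and `Tor_1^R(M,N) = 0 = Tor_2^R(M,N)`, then `M = 0` or `N = 0`. -/
theorem stmt_6 (S T k : Type) [CommRing S] [CommRing T] [Field k]
    [IsNoetherianRing S] [IsNoetherianRing T] [IsLocalRing S] [IsLocalRing T]
    (πS : S →+* k) (πT : T →+* k)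
    (hπS : Function.Surjective πS) (hπT : Function.Surjective πT)
    (hkS : RingHom.ker πS = maximalIdeal S) (hkT : RingHom.ker πT = maximalIdeal T)
    (hS : maximalIdeal S ≠ ⊥) (hT : maximalIdeal T ≠ ⊥)
    (M1 N1 : Type) [AddCommGroup M1] [Module S M1] [Module.Finite S M1]
    [AddCommGroup N1] [Module S N1] [Module.Finite S N1]
    (M2 N2 : Type) [AddCommGroup M2] [Module T M2] [Module.Finite T M2]
    [AddCommGroup N2] [Module T N2] [Module.Finite T N2]
    (hM1 : IsFirstSyzygy S M1) (hN1 : IsFirstSyzygy S N1)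
    (hM2 : IsFirstSyzygy T M2) (hN2 : IsFirstSyzygy T N2) :
    letI : Module ↥(fiberProd πS πT) M1 := Module.compHom M1 (ρS πS πT)
    letI : Module ↥(fiberProd πS πT) N1 := Module.compHom N1 (ρS πS πT)
    letI : Module ↥(fiberProd πS πT) M2 := Module.compHom M2 (ρT πS πT)
    letI : Module ↥(fiberProd πS πT) N2 := Module.compHom N2 (ρT πS πT)
    TorZero ↥(fiberProd πS πT) (M1 × M2) (N1 × N2) 1 →
    TorZero ↥(fiberProd πS πT) (M1 × M2) (N1 × N2) 2 →
      Subsingleton (M1 × M2) ∨ Subsingleton (N1 × N2) := by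
  intro h1 h2
  let _ : Module (fiberProd πS πT) M1 := Module.compHom M1 (ρS πS πT)
  let _ : Module (fiberProd πS πT) N1 := Module.compHom N1 (ρS πS πT)
  let _ : Module (fiberProd πS πT) M2 := Module.compHom M2 (ρT πS πT)
  let _ : Module (fiberProd πS πT) N2 := Module.compHom N2 (ρT πS πT)
  by_contra! hne
  obtain ⟨hM, hN⟩ := hne
  let _ : Algebra (fiberProd πS πT) k := (πS.comp (ρS πS πT)).toAlgebra
  have hρS : ∀ r, algebraMap (fiberProd πS πT) k r = πS (ρS πS πT r) := fun _ => rfl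
  have hρT : ∀ r, algebraMap (fiberProd πS πT) k r = πT (ρT πS πT r) := fun r => r.2
  have hsurj : Function.Surjective (algebraMap (fiberProd πS πT) k) := fun c => by
    obtain ⟨s, hs⟩ := hπS c
    obtain ⟨t, ht⟩ := hπT c
    exact ⟨⟨(s, t), hs.trans ht.symm⟩, hs⟩
  obtain ⟨s, hs, hsd⟩ := exists_isDetected πS hkS (ρS πS πT) hρS hS
  obtain ⟨t, ht, htd⟩ := exists_isDetected πT hkT (ρT πS πT) hρT hT
  rw [← hkS, RingHom.mem_ker] at hs
  rw [← hkT, RingHom.mem_ker] at ht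
  let a : fiberProd πS πT := ⟨(s, 0), hs.trans (map_zero πT).symm⟩
  let b : fiberProd πS πT := ⟨(0, t), (map_zero πS).trans ht.symm⟩
  have ha : IsDetected k a := hsd a rfl
  have hb : IsDetected k b := htd b rfl
  have hab : a * b = 0 := Subtype.ext (Prod.ext (mul_zero s) (zero_mul t))
  have hba : b * a = 0 := by rw [mul_comm, hab]
  have hbM : ∀ m : M1, b • ((m, 0) : M1 × M2) = 0 := fun m =>
    Prod.ext (zero_smul S m) (smul_zero b)
  have hbN : ∀ m : N1, b • ((m, 0) : N1 × N2) = 0 := fun m =>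
    Prod.ext (zero_smul S m) (smul_zero b)
  have haM : ∀ m : M2, a • ((0, m) : M1 × M2) = 0 := fun m =>
    Prod.ext (smul_zero a) (zero_smul T m)
  have haN : ∀ m : N2, a • ((0, m) : N1 × N2) = 0 := fun m =>
    Prod.ext (smul_zero a) (zero_smul T m)
  have split : ∀ {U V : Type}, ¬ Subsingleton (U × V) → ¬ Subsingleton U ∨ ¬ Subsingleton V :=
    fun h => by
      by_contra! h'
      obtain ⟨_, _⟩ := h'
      exact h inferInstance
  rcases split (not_subsingleton_iff_nontrivial.2 hM) with hM | hM <;>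
    rcases split (not_subsingleton_iff_nontrivial.2 hN) with hN | hN
  · obtain ⟨φ, x, hx⟩ := exists_linear_functional πS hkS (ρS πS πT) hρS (fun _ _ => rfl) hM
    obtain ⟨g, y, hy⟩ := exists_linear_functional πS hkS (ρS πS πT) hρS (fun _ _ => rfl) hN
    exact not_torZero_one hsurj (φ ∘ₗ LinearMap.fst _ M1 M2) (x, 0) hx
      (g ∘ₗ LinearMap.fst _ N1 N2) (y, 0) hy b hb (hbM x) (hbN y) h1
  · obtain ⟨φ, x, hx⟩ := exists_linear_functional πS hkS (ρS πS πT) hρS (fun _ _ => rfl) hM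
    obtain ⟨g, y, hy⟩ := exists_linear_functional πT hkT (ρT πS πT) hρT (fun _ _ => rfl) hN
    exact not_torZero_two hsurj (φ ∘ₗ LinearMap.fst _ M1 M2) (x, 0) hx
      (g ∘ₗ LinearMap.snd _ N1 N2) (0, y) hy b a hb ha hba (hbM x) (haN y) h2
  · obtain ⟨φ, x, hx⟩ := exists_linear_functional πT hkT (ρT πS πT) hρT (fun _ _ => rfl) hM
    obtain ⟨g, y, hy⟩ := exists_linear_functional πS hkS (ρS πS πT) hρS (fun _ _ => rfl) hN
    exact not_torZero_two hsurj (φ ∘ₗ LinearMap.snd _ M1 M2) (0, x) hx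
      (g ∘ₗ LinearMap.fst _ N1 N2) (y, 0) hy a b ha hb hab (haM x) (hbN y) h2
  · obtain ⟨φ, x, hx⟩ := exists_linear_functional πT hkT (ρT πS πT) hρT (fun _ _ => rfl) hM
    obtain ⟨g, y, hy⟩ := exists_linear_functional πT hkT (ρT πS πT) hρT (fun _ _ => rfl) hN
    exact not_torZero_one hsurj (φ ∘ₗ LinearMap.snd _ M1 M2) (0, x) hx
      (g ∘ₗ LinearMap.snd _ N1 N2) (0, y) hy a ha (haM x) (haN y) h1
end
end

section
/- Let (S, m_S, k) be a commutative noetherian local ring with S ≠ k, and let S ⋉ k denote the trivial (square-zero) extension of S by k. If M and N are nonzero finitely generated S ⋉ k-modules such that Tor_i^{S⋉k}(M, N) = 0 for some i ≥ 5, then M is free over S ⋉ k or N is free over S ⋉ k. -/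
open CategoryTheory Opposite IsLocalRing

noncomputable section

namespace CategoryTheory.ProjectiveResolution

variable {C : Type*} [Category* C] [Abelian C] {S : ShortComplex C}

/-- The augmentation map of a projective resolution. -/
def augmentation {Z : C} (Q : ProjectiveResolution Z) : Q.complex.X 0 ⟶ Z := Q.π.f 0

lemma d_comp_augmentation {Z : C} (Q : ProjectiveResolution Z) :
    Q.complex.d 1 0 ≫ Q.augmentation = 0 :=
  Q.complex_d_comp_π_f_zero

instance {Z : C} (Q : ProjectiveResolution Z) : Epi Q.augmentation :=
  inferInstanceAs (Epi (Q.π.f 0))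

/-- The complex obtained by splicing a projective resolution of the first term of a
short complex with its last two terms. -/
def spliceComplex (Q : ProjectiveResolution S.X₁) : ChainComplex C ℕ :=
  Q.complex.augment (Q.augmentation ≫ S.f) (by
    rw [← Category.assoc, Q.d_comp_augmentation, Limits.zero_comp])

lemma spliceComplex_exactAt_succ (hS : S.ShortExact) (Q : ProjectiveResolution S.X₁) (n : ℕ) :
    (spliceComplex Q).ExactAt (n + 1) := by
  rw [HomologicalComplex.exactAt_iff' _ (n + 1 + 1) (n + 1) n (by simp) (by simp)]
  match n with
  | 0 =>
    have := hS.mono_f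
    let φ : ShortComplex.mk _ _ Q.d_comp_augmentation ⟶ (spliceComplex Q).sc' 2 1 0 :=
      { τ₁ := 𝟙 _
        τ₂ := 𝟙 _
        τ₃ := S.f
        comm₁₂ := (Category.id_comp _).trans (Category.comp_id _).symm
        comm₂₃ := Category.id_comp _ }
    have : Epi φ.τ₁ := inferInstanceAs (Epi (𝟙 _))
    have : IsIso φ.τ₂ := inferInstanceAs (IsIso (𝟙 _))
    have : Mono φ.τ₃ := hS.mono_f
    exact (ShortComplex.exact_iff_of_epi_of_isIso_of_mono φ).1 Q.exact₀
  | n + 1 => exact Q.exact_succ n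

/-- Given a short exact sequence with projective middle term, a projective resolution of the
first term yields one of the last term. -/
def splice (hS : S.ShortExact) [Projective S.X₂] (Q : ProjectiveResolution S.X₁) :
    ProjectiveResolution S.X₃ where
  complex := spliceComplex Q
  projective n := by
    cases n with
    | zero => exact inferInstanceAs (Projective S.X₂)
    | succ n => exact inferInstanceAs (Projective (Q.complex.X n))
  π := (ChainComplex.toSingle₀Equiv _ _).symm ⟨S.g, by
    change (Q.augmentation ≫ S.f) ≫ S.g = 0
    rw [Category.assoc, S.zero, Limits.comp_zero]⟩
  quasiIso := ⟨fun n => by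
    cases n with
    | zero =>
      have := hS.epi_g
      rw [ChainComplex.quasiIsoAt₀_iff, ShortComplex.quasiIso_iff_of_zeros' _ rfl rfl rfl]
      let φ : ShortComplex.mk (Q.augmentation ≫ S.f) S.g
          (by rw [Category.assoc, S.zero, Limits.comp_zero]) ⟶ S :=
        { τ₁ := Q.augmentation
          τ₂ := 𝟙 _
          τ₃ := 𝟙 _
          comm₁₂ := (Category.comp_id _).symm
          comm₂₃ := (Category.id_comp _).trans (Category.comp_id _).symm }
      have : Epi φ.τ₁ := inferInstanceAs (Epi Q.augmentation)
      have : IsIso φ.τ₂ := inferInstanceAs (IsIso (𝟙 _))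
      have : Mono φ.τ₃ := inferInstanceAs (Mono (𝟙 _))
      have h := (ShortComplex.exact_iff_of_epi_of_isIso_of_mono φ).2 hS.exact
      refine (ShortComplex.exact_and_epi_g_iff_of_iso ?_).1 ⟨h, hS.epi_g⟩
      exact ShortComplex.isoMk (Iso.refl _) (Iso.refl _) (Iso.refl _)
        ((Category.id_comp _).trans (Category.comp_id _).symm)
        ((Category.id_comp _).trans
          ((ChainComplex.toSingle₀Equiv_symm_apply_f_zero (C := spliceComplex Q) S.g _).trans
            (Category.comp_id _).symm))
    | succ n =>
      rw [quasiIsoAt_iff_exactAt']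
      · exact spliceComplex_exactAt_succ hS Q n
      · exact ChainComplex.exactAt_succ_single_obj _ _⟩

end CategoryTheory.ProjectiveResolution

namespace CategoryTheory.Functor

variable {C D : Type*} [Category* C] [Abelian C] [EnoughProjectives C] [Category* D] [Abelian D]
  (F : C ⥤ D) [F.Additive]

lemma isZero_leftDerived_succ_iff {X : C} (P : ProjectiveResolution X) (n : ℕ) :
    Limits.IsZero ((F.leftDerived (n + 1)).obj X) ↔
      (((F.mapHomologicalComplex _).obj P.complex).sc' (n + 2) (n + 1) n).Exact := by
  rw [(P.isoLeftDerivedObj F (n + 1)).isZero_iff,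
    ← HomologicalComplex.exactAt_iff' _ (n + 2) (n + 1) n (by simp) (by simp),
    HomologicalComplex.exactAt_iff_isZero_homology]
  rfl

lemma isZero_leftDerived_of_shortExact {S : ShortComplex C} (hS : S.ShortExact)
    [Projective S.X₂] (n : ℕ) (h : Limits.IsZero ((F.leftDerived (n + 2)).obj S.X₃)) :
    Limits.IsZero ((F.leftDerived (n + 1)).obj S.X₁) := by
  let Q := ProjectiveResolution.of S.X₁
  exact (F.isZero_leftDerived_succ_iff Q n).2
    ((F.isZero_leftDerived_succ_iff (Q.splice hS) (n + 1)).1 h)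

end CategoryTheory.Functor

section Tor

variable {A : Type} [CommRing A] (M : Type) [AddCommGroup M] [Module A M]

lemma torZero_of_retract {K L : Type} [AddCommGroup K] [Module A K] [AddCommGroup L]
    [Module A L] (s : L →ₗ[A] K) (r : K →ₗ[A] L) (h : r ∘ₗ s = LinearMap.id) (n : ℕ)
    (hK : TorZero A M K n) : TorZero A M L n := by
  have hz := ModuleCat.isZero_iff_subsingleton.2 hK
  refine ModuleCat.isZero_iff_subsingleton.1 ((Limits.IsZero.iff_id_eq_zero _).2 ?_)
  rw [← CategoryTheory.Functor.map_id, ← ModuleCat.ofHom_id, ← h, ModuleCat.ofHom_comp,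
    Functor.map_comp, hz.eq_zero_of_tgt (((Tor (ModuleCat A) n).obj _).map (ModuleCat.ofHom s)),
    Limits.zero_comp]

variable {F L : Type} [AddCommGroup F] [Module A F] [Module.Projective A F] [AddCommGroup L]
  [Module A L] {f : F →ₗ[A] L}

lemma torZero_ker (hf : Function.Surjective f) (n : ℕ) (h : TorZero A M L (n + 2)) :
    TorZero A M (LinearMap.ker f) (n + 1) := by
  have : Projective (LinearMap.shortComplexKer f).X₂ :=
    inferInstanceAs (Projective (ModuleCat.of A F))
  exact ModuleCat.isZero_iff_subsingleton.1
    (Functor.isZero_leftDerived_of_shortExact _ (LinearMap.shortExact_shortComplexKer hf) n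
      (ModuleCat.isZero_iff_subsingleton.2 h))

lemma lTensor_ker_subtype_injective (hf : Function.Surjective f) (h : TorZero A M L 1) :
    Function.Injective ((LinearMap.ker f).subtype.lTensor M) := by
  have : Projective (LinearMap.shortComplexKer f).X₂ :=
    inferInstanceAs (Projective (ModuleCat.of A F))
  let Q := ProjectiveResolution.of (LinearMap.shortComplexKer f).X₁
  have hex := (Functor.isZero_leftDerived_succ_iff _
    (Q.splice (LinearMap.shortExact_shortComplexKer hf)) 0).1
      (ModuleCat.isZero_iff_subsingleton.2 h)
  rw [ShortComplex.moduleCat_exact_iff] at hex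
  let p : Q.complex.X 0 →ₗ[A] LinearMap.ker f := Q.augmentation.hom
  let d : Q.complex.X 1 →ₗ[A] Q.complex.X 0 := (Q.complex.d 1 0).hom
  have hpd : p ∘ₗ d = 0 := congrArg ModuleCat.Hom.hom Q.d_comp_augmentation
  have hp : Function.Surjective p := (ModuleCat.epi_iff_surjective Q.augmentation).1 inferInstance
  have hex' : ∀ y : TensorProduct A M (Q.complex.X 0),
      ((LinearMap.ker f).subtype ∘ₗ p).lTensor M y = 0 → ∃ w, d.lTensor M w = y := hex
  rw [injective_iff_map_eq_zero]
  intro z hz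
  obtain ⟨y, rfl⟩ := LinearMap.lTensor_surjective M hp z
  obtain ⟨w, rfl⟩ := hex' y (by rwa [LinearMap.lTensor_comp])
  rw [← LinearMap.comp_apply, ← LinearMap.lTensor_comp, hpd, LinearMap.lTensor_zero,
    LinearMap.zero_apply]

end Tor

section LocalRing

variable {A : Type*} [CommRing A] [IsLocalRing A]

/-- A finitely generated module over a local ring is a quotient of a finite free module by a
submodule whose elements have all their coordinates in the maximal ideal. -/
lemma exists_minimal_cover (L : Type*) [AddCommGroup L] [Module A L] [Module.Finite A L] :
    ∃ (n : ℕ) (f : (Fin n → A) →ₗ[A] L), Function.Surjective f ∧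
      ∀ v ∈ LinearMap.ker f, ∀ j, v j ∈ maximalIdeal A := by
  let b := Module.finBasis (ResidueField A) (TensorProduct A (ResidueField A) L)
  choose g hg using fun j ↦ TensorProduct.mk_surjective A L (ResidueField A)
    Ideal.Quotient.mk_surjective (b j)
  have hg' : ∀ j, (1 : ResidueField A) ⊗ₜ[A] g j = b j := hg
  refine ⟨_, Fintype.linearCombination A g, ?_, fun v hv j ↦ ?_⟩
  · rw [← LinearMap.range_eq_top, Fintype.range_linearCombination]
    exact span_eq_top_of_tmul_eq_basis g b hg'
  · rw [LinearMap.mem_ker, Fintype.linearCombination_apply] at hv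
    have h := congrArg (fun l : L ↦ (1 : ResidueField A) ⊗ₜ[A] l) hv
    simp only [TensorProduct.tmul_sum, TensorProduct.tmul_smul, TensorProduct.tmul_zero, hg'] at h
    have h' : ∑ j, residue A (v j) • b j = 0 := by
      rw [← h]
      exact Finset.sum_congr rfl fun j _ ↦ (algebraMap_smul (ResidueField A) (v j) (b j))
    exact Ideal.Quotient.eq_zero_iff_mem.1
      (Fintype.linearIndependent_iff.1 b.linearIndependent _ h' j)

lemma exists_cover_ker_smul_eq_zero {x : A} (hx : ∀ a ∈ maximalIdeal A, a * x = 0)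
    (L : Type*) [AddCommGroup L] [Module A L]
    [Module.Finite A L] (hL : ¬ Module.Free A L) :
    ∃ (n : ℕ) (f : (Fin n → A) →ₗ[A] L), Function.Surjective f ∧
      Nontrivial (LinearMap.ker f) ∧ ∀ v : LinearMap.ker f, x • v = 0 := by
  obtain ⟨n, f, hf, hker⟩ := exists_minimal_cover (A := A) L
  refine ⟨n, f, hf, ?_, fun v ↦ ?_⟩
  · rw [Submodule.nontrivial_iff_ne_bot]
    exact fun h ↦ hL (Module.Free.of_equiv
      (LinearEquiv.ofBijective f ⟨LinearMap.ker_eq_bot.1 h, hf⟩))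
  · ext j
    simpa [mul_comm] using hx _ (hker v v.2 j)

/-- If `x` spans a direct summand of the maximal ideal isomorphic to the residue field, then the
residue field is a direct summand of the first syzygy of every nonzero finitely generated module
killed by `x`. -/
lemma exists_cover_residueField_retract {x : A} (hx : ∀ a ∈ maximalIdeal A, a * x = 0)
    (hxm : x ∈ maximalIdeal A)
    (φ : maximalIdeal A →ₗ[A] ResidueField A) (hφ : φ ⟨x, hxm⟩ = 1)
    (L : Type*) [AddCommGroup L] [Module A L] [Module.Finite A L] [Nontrivial L]
    (hL : ∀ l : L, x • l = 0) :
    ∃ (n : ℕ) (f : (Fin n → A) →ₗ[A] L), Function.Surjective f ∧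
      ∃ (s : ResidueField A →ₗ[A] LinearMap.ker f) (r : LinearMap.ker f →ₗ[A] ResidueField A),
        r ∘ₗ s = LinearMap.id := by
  obtain ⟨n, f, hf, hker⟩ := exists_minimal_cover (A := A) L
  refine ⟨n, f, hf, ?_⟩
  have hn : n ≠ 0 := by
    rintro rfl
    exact not_subsingleton L hf.subsingleton
  let j : Fin n := ⟨0, Nat.pos_of_ne_zero hn⟩
  let e : LinearMap.ker f := ⟨x • Pi.single j 1, by rw [LinearMap.mem_ker, map_smul, hL]⟩
  let s : ResidueField A →ₗ[A] LinearMap.ker f :=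
    (maximalIdeal A).liftQ (LinearMap.toSpanSingleton A _ e) fun a ha ↦ by
      rw [LinearMap.mem_ker, LinearMap.toSpanSingleton_apply]
      ext i
      simp [e, ← mul_assoc, hx a ha]
  let r : LinearMap.ker f →ₗ[A] ResidueField A :=
    φ ∘ₗ ((LinearMap.proj j ∘ₗ (LinearMap.ker f).subtype).codRestrict (maximalIdeal A)
      fun v ↦ hker v v.2 j)
  refine ⟨s, r, ?_⟩
  refine Submodule.linearMap_qext _ (LinearMap.ext_ring ?_)
  change r ((1 : A) • e) = 1
  rw [one_smul, ← hφ]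
  refine congrArg φ (Subtype.ext ?_)
  change x * (Pi.single j 1 : Fin n → A) j = x
  rw [Pi.single_eq_same, mul_one]

end LocalRing

/-- Over a noetherian local ring whose maximal ideal has a direct summand isomorphic to the residue
field, the vanishing of some `Tor_i` with `i ≥ 3` of two finitely generated modules forces one
of them to be free. -/
theorem free_or_free_of_torZero {A : Type} [CommRing A] [IsLocalRing A] [IsNoetherianRing A]
    {x : A} (hx : ∀ a ∈ maximalIdeal A, a * x = 0) (hxm : x ∈ maximalIdeal A)
    (φ : maximalIdeal A →ₗ[A] ResidueField A) (hφ : φ ⟨x, hxm⟩ = 1)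
    (M N : Type) [AddCommGroup M] [Module A M] [Module.Finite A M]
    [AddCommGroup N] [Module A N] [Module.Finite A N] (n : ℕ) (h : TorZero A M N (n + 3)) :
    Module.Free A M ∨ Module.Free A N := by
  refine or_iff_not_imp_right.2 fun hN ↦ ?_
  obtain ⟨_, f, hf, _, hker⟩ := exists_cover_ker_smul_eq_zero hx N hN
  have hresidue : ∀ (L : Type) [AddCommGroup L] [Module A L] [Module.Finite A L] [Nontrivial L],
      (∀ l : L, x • l = 0) → ∀ m, TorZero A M L (m + 2) →
        TorZero A M (ResidueField A) (m + 1) := by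
    intro L _ _ _ _ hL m hm
    obtain ⟨_, g, hg, s, r, hrs⟩ := exists_cover_residueField_retract hx hxm φ hφ L hL
    exact torZero_of_retract M s r hrs _ (torZero_ker M hg _ hm)
  have hk : ∀ m, TorZero A M (ResidueField A) (m + 1) → TorZero A M (ResidueField A) 1 := by
    intro m
    induction m with
    | zero => exact id
    | succ m ih =>
      refine fun hm ↦ ih (hresidue _ (fun l ↦ ?_) m hm)
      rw [← algebraMap_smul (ResidueField A) x l]
      have : algebraMap A (ResidueField A) x = 0 := Ideal.Quotient.eq_zero_iff_mem.2 hxm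
      rw [this, zero_smul]
  have h1 := hk _ (hresidue _ hker _ (torZero_ker M hf _ h))
  have := Module.finitePresentation_of_finite A M
  have hinj := lTensor_ker_subtype_injective M (f := (maximalIdeal A).mkQ)
    (Submodule.mkQ_surjective _) h1
  rw [Submodule.ker_mkQ] at hinj
  exact Module.free_of_maximalIdeal_rTensor_injective
    ((LinearMap.lTensor_inj_iff_rTensor_inj _ _).1 hinj)

namespace TrivSqZeroExt

variable (S : Type*) [CommRing S] [IsLocalRing S]

instance : IsLocalRing (TrivSqZeroExt S (S ⧸ maximalIdeal S)) :=
  .of_isUnit_or_isUnit_one_sub_self fun a ↦ by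
    simpa only [isUnit_iff_isUnit_fst, fst_sub, fst_one] using
      isUnit_or_isUnit_one_sub_self a.fst

lemma mem_maximalIdeal_iff {a : TrivSqZeroExt S (S ⧸ maximalIdeal S)} :
    a ∈ maximalIdeal (TrivSqZeroExt S (S ⧸ maximalIdeal S)) ↔ a.fst ∈ maximalIdeal S := by
  simp only [mem_maximalIdeal, mem_nonunits_iff, isUnit_iff_isUnit_fst]

lemma mul_inr_one_of_mem_maximalIdeal (a : TrivSqZeroExt S (S ⧸ maximalIdeal S))
    (ha : a ∈ maximalIdeal (TrivSqZeroExt S (S ⧸ maximalIdeal S))) : a * inr 1 = 0 := by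
  have : a.fst • (1 : S ⧸ maximalIdeal S) = 0 := by
    rw [Algebra.smul_def, mul_one]
    exact Ideal.Quotient.eq_zero_iff_mem.2 ((mem_maximalIdeal_iff S).1 ha)
  ext <;> simp [this]

instance [IsNoetherianRing S] : IsNoetherianRing (TrivSqZeroExt S (S ⧸ maximalIdeal S)) :=
  have : Module.Finite S (TrivSqZeroExt S (S ⧸ maximalIdeal S)) :=
    inferInstanceAs (Module.Finite S (S × (S ⧸ maximalIdeal S)))
  have : IsScalarTower S (TrivSqZeroExt S (S ⧸ maximalIdeal S))
      (TrivSqZeroExt S (S ⧸ maximalIdeal S)) :=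
    ⟨fun s a b ↦ TrivSqZeroExt.ext (by simp [mul_assoc]) (by
      simp only [smul_eq_mul, snd_smul, snd_mul, fst_smul, op_smul_eq_smul, smul_add, smul_smul,
        mul_comm, add_comm])⟩
  .of_finite S _

/-- The map from the residue field of `S` to that of the trivial extension of `S`. -/
def residueMap :
    S ⧸ maximalIdeal S →+* ResidueField (TrivSqZeroExt S (S ⧸ maximalIdeal S)) :=
  Ideal.Quotient.lift _ ((residue _).comp (inlHom S (S ⧸ maximalIdeal S))) fun _ ha ↦
    Ideal.Quotient.eq_zero_iff_mem.2 ((mem_maximalIdeal_iff S).2 ha)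

lemma residueMap_mk_fst (a : TrivSqZeroExt S (S ⧸ maximalIdeal S)) :
    residueMap S (Ideal.Quotient.mk _ a.fst) = residue _ a := by
  refine Ideal.Quotient.eq.2 ((mem_maximalIdeal_iff S).2 ?_)
  simp

/-- The projection of the maximal ideal of the trivial extension onto its summand given by the
residue field. -/
def maximalIdealSnd : maximalIdeal (TrivSqZeroExt S (S ⧸ maximalIdeal S)) →ₗ[
    TrivSqZeroExt S (S ⧸ maximalIdeal S)]
      ResidueField (TrivSqZeroExt S (S ⧸ maximalIdeal S)) where
  toFun a := residueMap S a.1.snd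
  map_add' a b := by simp
  map_smul' c a := by
    have ha : a.1.fst • c.snd = 0 := by
      rw [Algebra.smul_def]
      refine mul_eq_zero_of_left (Ideal.Quotient.eq_zero_iff_mem.2 ?_) _
      exact (mem_maximalIdeal_iff S).1 a.2
    rw [RingHom.id_apply, Submodule.coe_smul, smul_eq_mul, snd_mul, op_smul_eq_smul, ha, add_zero,
      Algebra.smul_def, map_mul, Algebra.smul_def]
    exact congrArg (· * _) (residueMap_mk_fst S c)

end TrivSqZeroExt

/-- Corollary 2.8: if `M`, `N` are nonzero finitely generated modules over the trivial
extension `S ⋉ k` (with `k` the residue field of `S`) and `Tor_i^{S⋉k}(M,N) = 0` for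
some `i ≥ 5`, then `M` or `N` is free over `S ⋉ k`. -/
theorem stmt_8 (S : Type) [CommRing S] [IsNoetherianRing S] [IsLocalRing S]
    (hS : maximalIdeal S ≠ ⊥)
    (M N : Type) [AddCommGroup M] [Module (TrivSqZeroExt S (S ⧸ maximalIdeal S)) M]
    [Module.Finite (TrivSqZeroExt S (S ⧸ maximalIdeal S)) M] [Nontrivial M]
    [AddCommGroup N] [Module (TrivSqZeroExt S (S ⧸ maximalIdeal S)) N]
    [Module.Finite (TrivSqZeroExt S (S ⧸ maximalIdeal S)) N] [Nontrivial N]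
    (i : ℕ) (hi : 5 ≤ i)
    (hvan : TorZero (TrivSqZeroExt S (S ⧸ maximalIdeal S)) M N i) :
    Module.Free (TrivSqZeroExt S (S ⧸ maximalIdeal S)) M ∨
      Module.Free (TrivSqZeroExt S (S ⧸ maximalIdeal S)) N := by
  obtain ⟨n, rfl⟩ := Nat.exists_eq_add_of_le' ((by norm_num : 3 ≤ 5).trans hi)
  have hxm : TrivSqZeroExt.inr 1 ∈ maximalIdeal (TrivSqZeroExt S (S ⧸ maximalIdeal S)) :=
    (TrivSqZeroExt.mem_maximalIdeal_iff S).2 (by simp)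
  exact free_or_free_of_torZero (TrivSqZeroExt.mul_inr_one_of_mem_maximalIdeal S) hxm
    (TrivSqZeroExt.maximalIdealSnd S) (map_one (TrivSqZeroExt.residueMap S)) M N n hvan
end
end
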